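/- Let α > 0 and define, for β > 0, a(d,n) = exp(−β·k(d,n)^α). Then there exist constants c > 0 and C > 0 depending only on α such that for all β > 0 and all integers d ≥ 2: (i) for 2 ≤ n ≤ d, c·β ≤ −ln a(d,n) ≤ C·β; (ii) for d ≤ n ≤ 2^d, c·β·(ln n/ln(1+d/ln n))^α ≤ −ln a(d,n) ≤ C·β·(ln n/ln(1+d/ln n))^α; (iii) for n ≥ 2^d, c·β·d^α·n^{α/d} ≤ −ln a(d,n) ≤ C·β·d^α·n^{α/d}. -/

import Mathlib

/-- `C(d,k) = (2k+d)·(k+d−1)!/(k!·d!)`, the dimension of the space of spherical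
polynomials of degree at most `k` on the sphere `S^d`, as a real number. -/
noncomputable def sphC (d k : ℕ) : ℝ :=
  ((2 * k + d : ℕ) : ℝ) * (Nat.factorial (k + d - 1) : ℝ) /
    ((Nat.factorial k : ℝ) * (Nat.factorial d : ℝ))

/-- The approximation numbers `a(d,n) = exp(−β·k(d,n)^α)` of the Gevrey embedding
`I_d : G^{α,β}(S^d) → L₂(S^d)`, expressed via an index function `kf` with
`kf n = k(d,n)`. -/
noncomputable def aGev (α β : ℝ) (kf : ℕ → ℕ) (n : ℕ) : ℝ :=
  Real.exp (-β * (kf n : ℝ) ^ α)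

theorem one_add_div_pow_le_choose (a b : ℕ) (hb : 0 < b) :
    (1 + (a : ℝ) / b) ^ b ≤ ((a + b).choose b : ℝ) := by
  have aux : ∀ i ≤ b, (a + b) ^ i * i.factorial ≤ b ^ i * (a + 1).ascFactorial i := by
    intro i
    induction i with
    | zero => simp
    | succ i ih =>
      intro hi
      have h1 := ih (by omega)
      have h2 : (a + b) * (i + 1) ≤ b * (a + 1 + i) := by nlinarith
      calc (a + b) ^ (i + 1) * (i + 1).factorial
          = ((a + b) * (i + 1)) * ((a + b) ^ i * i.factorial) := by
            rw [Nat.factorial_succ]; ring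
        _ ≤ (b * (a + 1 + i)) * (b ^ i * (a + 1).ascFactorial i) := Nat.mul_le_mul h2 h1
        _ = b ^ (i + 1) * (a + 1).ascFactorial (i + 1) := by
            rw [Nat.ascFactorial_succ]; ring
  have h := aux b le_rfl
  rw [Nat.ascFactorial_eq_factorial_mul_choose] at h
  have h' : (a + b) ^ b ≤ b ^ b * (a + b).choose b := by
    refine Nat.le_of_mul_le_mul_right ?_ (Nat.factorial_pos b)
    calc _ ≤ _ := h
      _ = _ := by ring
  have hb' : (0 : ℝ) < b := by exact_mod_cast hb
  have e : 1 + (a : ℝ) / b = (a + b) / b := by field_simp; ring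
  rw [e, div_pow, div_le_iff₀ (by positivity), mul_comm]
  exact_mod_cast h'

theorem sphC_mul_add (d k : ℕ) (hd : 1 ≤ d) :
    sphC d k * ((k : ℝ) + d) = (2 * k + d) * ((k + d).choose d : ℝ) := by
  obtain ⟨m, rfl⟩ : ∃ m, d = m + 1 := ⟨d - 1, by omega⟩
  have h : (k + (m + 1)).choose (m + 1) * (k.factorial * (m + 1).factorial) =
      (k + m + 1) * (k + m).factorial := by
    have h := Nat.add_choose_mul_factorial_mul_factorial k (m + 1)
    rw [← mul_assoc, h, ← add_assoc, Nat.factorial_succ]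
  have h' : ((k + (m + 1)).choose (m + 1) : ℝ) * (k.factorial * (m + 1).factorial) =
      (k + m + 1) * (k + m).factorial := by exact_mod_cast h
  have hk : (0 : ℝ) < k.factorial * (m + 1).factorial := by positivity
  have e : k + (m + 1) - 1 = k + m := by omega
  rw [sphC, e, div_mul_eq_mul_div, div_eq_iff hk.ne']
  push_cast
  linear_combination (-(2 * (k : ℝ) + m + 1)) * h'

theorem choose_le_sphC (d k : ℕ) (hd : 1 ≤ d) : ((k + d).choose d : ℝ) ≤ sphC d k := by
  have h := sphC_mul_add d k hd
  have hd' : (1 : ℝ) ≤ d := by exact_mod_cast hd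
  have hk : (0 : ℝ) ≤ k := by positivity
  have hc : (0 : ℝ) ≤ (k + d).choose d := by positivity
  have hs : (0 : ℝ) < (k : ℝ) + d := by positivity
  refine le_of_mul_le_mul_right ?_ hs
  rw [h]
  nlinarith

theorem sphC_le_two_mul_choose (d k : ℕ) (hd : 1 ≤ d) :
    sphC d k ≤ 2 * ((k + d).choose d : ℝ) := by
  have h := sphC_mul_add d k hd
  have hd' : (1 : ℝ) ≤ d := by exact_mod_cast hd
  have hk : (0 : ℝ) ≤ k := by positivity
  have hc : (0 : ℝ) ≤ (k + d).choose d := by positivity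
  have hs : (0 : ℝ) < (k : ℝ) + d := by positivity
  refine le_of_mul_le_mul_right ?_ hs
  rw [h]
  nlinarith

theorem one_add_div_pow_le_sphC (d k : ℕ) (hd : 1 ≤ d) : (1 + (k : ℝ) / d) ^ d ≤ sphC d k :=
  (one_add_div_pow_le_choose k d hd).trans (choose_le_sphC d k hd)

theorem one_add_div_pow_le_sphC' (d k : ℕ) (hd : 1 ≤ d) (hk : 1 ≤ k) :
    (1 + (d : ℝ) / k) ^ k ≤ sphC d k := by
  refine (one_add_div_pow_le_choose d k hk).trans ?_
  rw [add_comm d k, Nat.choose_symm_add]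
  exact choose_le_sphC d k hd

theorem sphC_le_of_pos (d k : ℕ) (hd : 1 ≤ d) {x : ℝ} (hx : 0 < x) :
    sphC d k ≤ 2 * ((1 + x) ^ d * (1 + 1 / x) ^ k) := by
  refine (sphC_le_two_mul_choose d k hd).trans ?_
  have h : x ^ k * ((k + d).choose k : ℝ) ≤ (x + 1) ^ (k + d) := by
    rw [add_pow]
    have := Finset.single_le_sum
      (f := fun m => x ^ m * 1 ^ (k + d - m) * ((k + d).choose m : ℝ))
      (s := Finset.range (k + d + 1)) (fun i _ => by positivity)
      (Finset.mem_range.2 (by omega : k < k + d + 1))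
    simpa using this
  have e : (1 + 1 / x) ^ k = (x + 1) ^ k / x ^ k := by
    rw [← div_pow]; congr 1; field_simp
  rw [← Nat.choose_symm_add, e, ← mul_div_assoc]
  refine mul_le_mul_of_nonneg_left ?_ (by norm_num)
  rw [le_div_iff₀ (by positivity), mul_comm]
  refine h.trans (le_of_eq ?_)
  rw [pow_add, add_comm x 1]; ring

theorem dim_le_mul_degree (d k : ℕ) (hd : 2 ≤ d) (hk : 1 ≤ k) (h : (2 : ℝ) ^ d ≤ sphC d k) :
    (d : ℝ) ≤ 20 * k := by
  by_contra! hlt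
  have hlt' : 20 * k ≤ d := by
    have : 20 * k < d := by exact_mod_cast hlt
    omega
  have h1 := h.trans (sphC_le_of_pos d k (by omega) (x := 1 / 4) (by norm_num))
  norm_num at h1
  have h2 : ((2 : ℝ) ^ d) ^ 2 ≤ (2 * ((5 / 4) ^ d * 5 ^ k)) ^ 2 := by gcongr
  have h3 : (4 : ℝ) ≤ 2 ^ d := by
    calc (4 : ℝ) = 2 ^ 2 := by norm_num
      _ ≤ 2 ^ d := pow_le_pow_right₀ (by norm_num) hd
  have e1 : ((2 : ℝ) ^ d) ^ 2 = 2 ^ d * (25 / 16) ^ d * (32 / 25) ^ d := by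
    rw [← mul_pow, ← mul_pow, ← pow_mul, mul_comm d 2, pow_mul]; norm_num
  have e2 : (2 * ((5 / 4 : ℝ) ^ d * 5 ^ k)) ^ 2 = 4 * (25 / 16) ^ d * 25 ^ k := by
    rw [mul_pow, mul_pow, ← pow_mul, ← pow_mul, mul_comm d 2, mul_comm k 2, pow_mul, pow_mul]
    norm_num; ring
  have h4 : (25 : ℝ) ^ k < (32 / 25) ^ d := by
    calc (25 : ℝ) ^ k < ((32 / 25) ^ 20) ^ k := pow_lt_pow_left₀ (by norm_num) (by norm_num) (by omega)
      _ = (32 / 25) ^ (20 * k) := by rw [pow_mul]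
      _ ≤ (32 / 25) ^ d := pow_le_pow_right₀ (by norm_num) hlt'
  have h5 : 4 * (25 / 16 : ℝ) ^ d * 25 ^ k < 2 ^ d * (25 / 16) ^ d * (32 / 25) ^ d :=
    mul_lt_mul' (by gcongr) h4 (by positivity) (by positivity)
  linarith

theorem rpow_inv_le_mul_degree_div (d k : ℕ) (n : ℝ) (hd : 2 ≤ d) (hk : 1 ≤ k)
    (hn : (2 : ℝ) ^ d ≤ n) (h : n ≤ sphC d k) :
    (d : ℝ) * n ^ (1 / (d : ℝ)) ≤ 126 * k := by
  have hdk := dim_le_mul_degree d k hd hk (hn.trans h)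
  have hd0 : (0 : ℝ) < d := by positivity
  have hk0 : (0 : ℝ) < k := by positivity
  have hn0 : 0 ≤ n := le_trans (by positivity) hn
  have h1 := h.trans (sphC_le_of_pos d k (by omega) (x := (k : ℝ) / d) (by positivity))
  have h2 : (1 + 1 / ((k : ℝ) / d)) ^ k ≤ 3 ^ d := by
    calc (1 + 1 / ((k : ℝ) / d)) ^ k ≤ (Real.exp ((d : ℝ) / k)) ^ k := by
          gcongr
          rw [one_div_div, add_comm]; exact Real.add_one_le_exp _
      _ = (Real.exp 1) ^ d := by
          rw [← Real.exp_nat_mul, ← Real.exp_nat_mul]; congr 1; field_simp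
      _ ≤ 3 ^ d := by
          gcongr
          linarith [Real.exp_one_lt_d9]
  have h3 : 1 + (k : ℝ) / d ≤ 21 * (k / d) := by
    have : 1 ≤ 20 * ((k : ℝ) / d) := by
      rw [← mul_div_assoc, le_div_iff₀ hd0]; linarith
    linarith
  have h4 : n ≤ (126 * ((k : ℝ) / d)) ^ d := by
    calc n ≤ 2 * ((1 + (k : ℝ) / d) ^ d * (1 + 1 / ((k : ℝ) / d)) ^ k) := h1
      _ ≤ 2 ^ d * ((21 * (k / d)) ^ d * 3 ^ d) := by
          gcongr
          exact le_self_pow₀ (by norm_num) (by omega)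
      _ = (126 * ((k : ℝ) / d)) ^ d := by
          rw [← mul_pow, ← mul_pow]; congr 1; ring
  have h5 : n ^ (1 / (d : ℝ)) ≤ 126 * ((k : ℝ) / d) := by
    calc n ^ (1 / (d : ℝ)) ≤ ((126 * ((k : ℝ) / d)) ^ d) ^ (1 / (d : ℝ)) := by gcongr
      _ = 126 * ((k : ℝ) / d) := by
          rw [one_div]; exact Real.pow_rpow_inv_natCast (by positivity) (by omega)
  calc (d : ℝ) * n ^ (1 / (d : ℝ)) ≤ d * (126 * ((k : ℝ) / d)) := by gcongr
    _ = 126 * k := by field_simp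

theorem degree_add_one_le_mul_rpow_inv (d j : ℕ) (n : ℝ) (hd : 1 ≤ d) (h : sphC d j ≤ n) :
    (j : ℝ) + 1 ≤ d * n ^ (1 / (d : ℝ)) := by
  have hd0 : (1 : ℝ) ≤ d := by exact_mod_cast hd
  have h1 := (one_add_div_pow_le_sphC d j hd).trans h
  have h2 : 1 + (j : ℝ) / d ≤ n ^ (1 / (d : ℝ)) := by
    calc 1 + (j : ℝ) / d = ((1 + (j : ℝ) / d) ^ d) ^ (1 / (d : ℝ)) := by
          rw [one_div, Real.pow_rpow_inv_natCast (by positivity) (by omega)]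
      _ ≤ n ^ (1 / (d : ℝ)) := by gcongr
  calc (j : ℝ) + 1 ≤ d * (1 + (j : ℝ) / d) := by field_simp; linarith
    _ ≤ d * n ^ (1 / (d : ℝ)) := by gcongr

theorem log_one_add_mul_le (m : ℕ) {x : ℝ} (hx : 0 < x) :
    Real.log (1 + m * x) ≤ m * Real.log (1 + x) := by
  rw [← Real.log_pow]
  exact Real.log_le_log (by positivity) (one_add_mul_le_pow (by linarith) m)

theorem log_le_mul_log_two {d : ℕ} {n : ℝ} (hn : 0 < n) (h : n ≤ 2 ^ d) :
    Real.log n ≤ d * Real.log 2 := by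
  rw [← Real.log_pow]; exact Real.log_le_log hn h

theorem log_two_le_log_one_add_div {d : ℕ} {n : ℝ} (hn : 1 < n) (h : n ≤ 2 ^ d) :
    Real.log 2 ≤ Real.log (1 + d / Real.log n) := by
  have hL := Real.log_pos hn
  have h1 := log_le_mul_log_two (by linarith) h
  refine Real.log_le_log (by norm_num) ?_
  have : 1 ≤ (d : ℝ) / Real.log n := by
    rw [le_div_iff₀ hL]
    have : (0 : ℝ) ≤ d := by positivity
    nlinarith [Real.log_two_lt_d9]
  linarith

theorem log_div_log_le_degree (d k : ℕ) (n : ℝ) (hd : 1 ≤ d) (hk : 1 ≤ k) (hn : 1 < n)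
    (hn2 : n ≤ 2 ^ d) (h : n ≤ sphC d k) :
    Real.log n / Real.log (1 + d / Real.log n) ≤ 7 * k := by
  have hL := Real.log_pos hn
  have hM := log_two_le_log_one_add_div hn hn2
  have hd0 : (0 : ℝ) < d := by exact_mod_cast hd
  have hk1 : (1 : ℝ) ≤ k := by exact_mod_cast hk
  have hl2 : 0 < Real.log 2 := Real.log_pos (by norm_num)
  set L := Real.log n with hLdef
  have hx : 0 < L / (4 * d) := by positivity
  have h1 := h.trans (sphC_le_of_pos d k hd hx)
  have h2 : L ≤ Real.log 2 + (d * Real.log (1 + L / (4 * d))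
      + k * Real.log (1 + 1 / (L / (4 * d)))) := by
    have := Real.log_le_log (by linarith) h1
    rwa [Real.log_mul (by norm_num) (by positivity), Real.log_mul (by positivity) (by positivity),
      Real.log_pow, Real.log_pow] at this
  have h3 : d * Real.log (1 + L / (4 * d)) ≤ L / 4 := by
    have h4 := Real.log_le_sub_one_of_pos (x := 1 + L / (4 * d)) (by positivity)
    calc d * Real.log (1 + L / (4 * d)) ≤ d * (L / (4 * d)) := by gcongr; linarith
      _ = L / 4 := by field_simp
  have h5 : Real.log (1 + 1 / (L / (4 * d))) ≤ 4 * Real.log (1 + d / L) := by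
    have := log_one_add_mul_le 4 (x := d / L) (by positivity)
    push_cast at this
    rwa [one_div_div, mul_div_assoc]
  rw [div_le_iff₀ (by linarith)]
  have h6 : k * Real.log (1 + 1 / (L / (4 * d))) ≤ k * (4 * Real.log (1 + d / L)) := by gcongr
  nlinarith

theorem degree_add_one_le_log_div_log (d j : ℕ) (n : ℝ) (hd : 2 ≤ d) (hn : d ≤ n)
    (hn2 : n ≤ 2 ^ d) (h : sphC d j ≤ n) :
    (j : ℝ) + 1 ≤ 5 * (Real.log n / Real.log (1 + d / Real.log n)) := by
  have hd2 : (2 : ℝ) ≤ d := by exact_mod_cast hd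
  have hL := Real.log_pos (x := n) (by linarith)
  have hM := log_two_le_log_one_add_div (by linarith) hn2
  have hl2 : 1 / 2 < Real.log 2 := by linarith [Real.log_two_gt_d9]
  have hL2 : Real.log 2 ≤ Real.log n := Real.log_le_log (by norm_num) (by linarith)
  have hLd : Real.log d ≤ Real.log n := Real.log_le_log (by linarith) hn
  set L := Real.log n with hLdef
  have hone : Real.log (1 + d / L) ≤ 3 * L := by
    have h1 : (d : ℝ) / L ≤ 2 * d := by
      rw [div_le_iff₀ hL]; nlinarith
    calc Real.log (1 + d / L) ≤ Real.log ((d : ℝ) ^ 3) := by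
          refine Real.log_le_log (by positivity) ?_
          nlinarith [mul_nonneg (by linarith : (0 : ℝ) ≤ d) (by nlinarith : (0 : ℝ) ≤ (d : ℝ) ^ 2 - 4)]
      _ = 3 * Real.log d := by rw [Real.log_pow]; norm_num
      _ ≤ 3 * L := by linarith
  have hj : j * Real.log (1 + d / L) ≤ 2 * L := by
    rcases Nat.eq_zero_or_pos j with rfl | hj
    · simp; linarith
    have hj0 : (0 : ℝ) < j := by exact_mod_cast hj
    have hjd : (j : ℝ) / d ≤ 1 := by
      have := ((one_add_div_pow_le_sphC d j (by omega)).trans h).trans hn2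
      have := (pow_le_pow_iff_left₀ (by positivity) (by norm_num) (by omega)).1 this
      linarith
    have hdj : 1 ≤ (d : ℝ) / j := by
      rw [div_le_one (by linarith)] at hjd
      rwa [one_le_div hj0]
    have h1 : j * Real.log (1 + d / j) ≤ L := by
      rw [← Real.log_pow]
      exact Real.log_le_log (by positivity)
        ((one_add_div_pow_le_sphC' d j (by omega) hj).trans h)
    have h2 : Real.log 2 ≤ Real.log (1 + d / j) := Real.log_le_log (by norm_num) (by linarith)
    have h3 : (j : ℝ) ≤ 2 * L := by nlinarith
    have h4 : Real.log (1 + d / L) ≤ 2 * Real.log (1 + d / j) := by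
      refine le_trans (Real.log_le_log (by positivity) ?_)
        (log_one_add_mul_le 2 (x := (d : ℝ) / j) (by positivity))
      have : (d : ℝ) / L ≤ 2 * (d / j) := by
        rw [← mul_div_assoc, div_le_div_iff₀ hL hj0]
        nlinarith
      push_cast
      linarith
    nlinarith
  rw [← mul_div_assoc, le_div_iff₀ (by linarith)]
  linarith

theorem neg_log_aGev (α β : ℝ) (kf : ℕ → ℕ) (n : ℕ) :
    -Real.log (aGev α β kf n) = β * (kf n : ℝ) ^ α := by
  rw [aGev, Real.log_exp]; ring

/-- Theorem 4.3: preasymptotics and asymptotics of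
`−ln a_n(I_d : G^{α,β}(S^d) → L₂(S^d))`, with constants depending only on `α`. -/
theorem gevrey_sphere_asymptotics (α : ℝ) (hα : 0 < α) :
    ∃ c C : ℝ, 0 < c ∧ 0 < C ∧
      ∀ β : ℝ, 0 < β → ∀ d : ℕ, 2 ≤ d → ∀ kf : ℕ → ℕ,
        (∀ n : ℕ, 1 ≤ n →
          (n : ℝ) ≤ sphC d (kf n) ∧ (0 < kf n → sphC d (kf n - 1) < (n : ℝ))) →
        (∀ n : ℕ, 2 ≤ n → n ≤ d →
          c * β ≤ -Real.log (aGev α β kf n) ∧ -Real.log (aGev α β kf n) ≤ C * β) ∧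
        (∀ n : ℕ, d ≤ n → n ≤ 2 ^ d →
          c * β * (Real.log n / Real.log (1 + (d : ℝ) / Real.log n)) ^ α ≤
            -Real.log (aGev α β kf n) ∧
          -Real.log (aGev α β kf n) ≤
            C * β * (Real.log n / Real.log (1 + (d : ℝ) / Real.log n)) ^ α) ∧
        (∀ n : ℕ, 2 ^ d ≤ n →
          c * β * (d : ℝ) ^ α * (n : ℝ) ^ (α / (d : ℝ)) ≤ -Real.log (aGev α β kf n) ∧
          -Real.log (aGev α β kf n) ≤ C * β * (d : ℝ) ^ α * (n : ℝ) ^ (α / (d : ℝ))) := by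
  refine ⟨(1 / 126) ^ α, 5 ^ α, by positivity, by positivity, ?_⟩
  intro β hβ d hd kf hkf
  have two_sided : ∀ {T : ℝ} {k : ℕ}, 0 ≤ T → T ≤ 126 * k → (k : ℝ) ≤ 5 * T →
      (1 / 126) ^ α * β * T ^ α ≤ β * (k : ℝ) ^ α ∧
        β * (k : ℝ) ^ α ≤ 5 ^ α * β * T ^ α := by
    intro T k hT h1 h2
    constructor
    · calc (1 / 126) ^ α * β * T ^ α = β * (1 / 126 * T) ^ α := by
            rw [Real.mul_rpow (by norm_num) hT]; ring
        _ ≤ β * (k : ℝ) ^ α := by gcongr; linarith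
    · calc β * (k : ℝ) ^ α ≤ β * (5 * T) ^ α := by gcongr
        _ = 5 ^ α * β * T ^ α := by rw [Real.mul_rpow (by norm_num) hT]; ring
  have kf_pos : ∀ n : ℕ, 2 ≤ n → 1 ≤ kf n := by
    intro n hn
    by_contra! h0
    have h0 : kf n = 0 := by omega
    have h1 := (hkf n (by omega)).1
    have h2 : (sphC d 0) * d = d := by simpa using sphC_mul_add d 0 (by omega)
    have h3 : sphC d 0 = 1 := mul_right_cancel₀ (b := (d : ℝ)) (by positivity) (by rw [h2, one_mul])
    rw [h0, h3] at h1
    have : (2 : ℝ) ≤ n := by exact_mod_cast hn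
    linarith
  have hd2 : (2 : ℝ) ≤ d := by exact_mod_cast hd
  simp only [neg_log_aGev]
  refine ⟨fun n hn hnd => ?_, fun n hn hn2 => ?_, fun n hn => ?_⟩
  · have h1 := kf_pos n hn
    have hk : kf n = 1 := by
      by_contra hne
      have h2 := (hkf n (by omega)).2 (by omega)
      have h3 := one_add_div_pow_le_sphC' d (kf n - 1) (by omega) (by omega)
      have hj : (0 : ℝ) < (kf n - 1 : ℕ) := by
        have : 0 < kf n - 1 := by omega
        exact_mod_cast this
      have h4 := one_add_mul_le_pow (a := (d : ℝ) / (kf n - 1 : ℕ))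
        (by have : (0 : ℝ) ≤ (d : ℝ) / (kf n - 1 : ℕ) := by positivity
            linarith) (kf n - 1)
      rw [mul_div_cancel₀ _ hj.ne'] at h4
      have : (n : ℝ) ≤ d := by exact_mod_cast hnd
      linarith
    have := two_sided (T := 1) (k := kf n) (by norm_num) (by rw [hk]; norm_num)
      (by rw [hk]; norm_num)
    simpa [hk] using this
  · have h1 := kf_pos n (by omega)
    obtain ⟨h2, h3⟩ := hkf n (by omega)
    have hn' : (d : ℝ) ≤ n := by exact_mod_cast hn
    have hn2' : (n : ℝ) ≤ 2 ^ d := by exact_mod_cast hn2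
    have hlow := log_div_log_le_degree d (kf n) n (by omega) h1 (by linarith) hn2' h2
    have hup := degree_add_one_le_log_div_log d (kf n - 1) n hd hn' hn2' (h3 h1).le
    have hk : ((kf n - 1 : ℕ) : ℝ) + 1 = kf n := by
      rw [Nat.cast_sub h1]; simp
    rw [hk] at hup
    have hk0 : (0 : ℝ) ≤ kf n := by positivity
    exact two_sided (by linarith) (by linarith) hup
  · have hn4 : 2 ^ 2 ≤ n := (Nat.pow_le_pow_right (by norm_num) hd).trans hn
    have h1 := kf_pos n (by omega)
    obtain ⟨h2, h3⟩ := hkf n (by omega)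
    have hn' : (2 : ℝ) ^ d ≤ n := by exact_mod_cast hn
    have hlow := rpow_inv_le_mul_degree_div d (kf n) n hd h1 hn' h2
    have hup := degree_add_one_le_mul_rpow_inv d (kf n - 1) n (by omega) (h3 h1).le
    have hk : ((kf n - 1 : ℕ) : ℝ) + 1 = kf n := by
      rw [Nat.cast_sub h1]; simp
    rw [hk] at hup
    have hT : (0 : ℝ) ≤ d * (n : ℝ) ^ (1 / (d : ℝ)) := by positivity
    have e : (d * (n : ℝ) ^ (1 / (d : ℝ))) ^ α = (d : ℝ) ^ α * (n : ℝ) ^ (α / (d : ℝ)) := by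
      rw [Real.mul_rpow (by positivity) (by positivity), ← Real.rpow_mul (by positivity)]
      congr 2; ring
    have := two_sided hT hlow (by linarith)
    rw [e] at this
    simpa only [mul_assoc] using this
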